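/- The numbers z(n) of plane 1-2 trees satisfy z(0) = 1 and, for every integer n >= 0, z(n+1) = (sum over i = 0,...,n of binomial(n,i) * z(i) * z(n-i)) - z(n) + delta(n,0), where delta(n,0) equals 1 if n = 0 and 0 otherwise. Equivalently, the exponential generating function Z(x) = sum over n >= 0 of z(n) x^n / n! satisfies the differential equation Z'(x) = Z(x)^2 - Z(x) + 1 with initial condition Z(0) = 1, and hence Z(x) = (sqrt(3)/2) * tan((sqrt(3)/2) x + pi/6) + 1/2. -/

import Mathlib

namespace BalancedTrees

/-- Plane binary trees with vertices labeled by natural numbers;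
`nil` is the empty tree, and each child of a vertex is designated
as a left child or a right child. -/
inductive BT where
  | nil : BT
  | node (label : ℕ) (l r : BT) : BT
deriving DecidableEq

namespace BT

/-- `balRank t = some k` if and only if the root of `t` is a balanced vertex of
rank `k`, i.e. every descending path from the root to a leaf has length `k`. -/
def balRank : BT → Option ℕ
  | .nil => none
  | .node _ .nil .nil => some 0
  | .node _ .nil (.node b rl rr) => (balRank (BT.node b rl rr)).map (· + 1)
  | .node _ (.node a ll lr) .nil => (balRank (BT.node a ll lr)).map (· + 1)
  | .node _ (.node a ll lr) (.node b rl rr) =>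
      match balRank (BT.node a ll lr), balRank (BT.node b rl rr) with
      | some i, some j => if i = j then some (i + 1) else none
      | _, _ => none

/-- The number of balanced vertices of rank `k` in the tree `t`. -/
def countBal (k : ℕ) : BT → ℕ
  | .nil => 0
  | .node v l r =>
      countBal k l + countBal k r +
        (if balRank (BT.node v l r) = some k then 1 else 0)

/-- The number of balanced vertices (of any rank) in the tree `t`. -/
def countBalAll : BT → ℕ
  | .nil => 0
  | .node v l r =>
      countBalAll l + countBalAll r +
        (if (balRank (BT.node v l r)).isSome then 1 else 0)

/-- Auxiliary, fuelled version of `treeOf`. -/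
def treeOfAux : ℕ → List ℕ → BT
  | 0, _ => .nil
  | _ + 1, [] => .nil
  | fuel + 1, l =>
      let m := l.foldr max 0
      BT.node m (treeOfAux fuel (l.takeWhile (· != m)))
                (treeOfAux fuel ((l.dropWhile (· != m)).tail))

/-- The decreasing binary tree `T(π)` of a sequence `π` of distinct labels:
the root is the maximum entry, and its left (resp. right) subtree is built
recursively from the part of the sequence to the left (resp. right) of the
maximum. This is a bijection between permutations of `{1,…,n}` and
decreasing binary trees on `{1,…,n}`. -/
def treeOf (l : List ℕ) : BT := treeOfAux l.length l

/-- Canonical form for non-plane 1-2 trees (as represented by plane trees):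
an only child is stored as a left child, and of two (unordered) children the
one with the larger label is stored on the left. Decreasing binary trees in
canonical form are in bijection with non-plane 1-2 trees. -/
def canonNP : BT → Bool
  | .nil => true
  | .node _ l r =>
      canonNP l && canonNP r &&
        (match l, r with
         | .nil, .nil => true
         | .node _ _ _, .nil => true
         | .nil, .node _ _ _ => false
         | .node a _ _, .node b _ _ => decide (b < a))

/-- Canonical form for plane 1-2 trees: an only child is stored as a left
child (an only child carries no left/right designation), while two children
remain ordered. Decreasing binary trees in canonical form are in bijection
with plane 1-2 trees. -/
def canonP : BT → Bool
  | .nil => true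
  | .node _ l r =>
      canonP l && canonP r &&
        (match l, r with
         | .nil, .node _ _ _ => false
         | _, _ => true)

end BT

open BT

/-- The list of all permutations of `{1,…,n}`, each written as a list. -/
def perms (n : ℕ) : List (List ℕ) := (List.range' 1 n).permutations

/-- `a n k`: the total number of balanced vertices of rank `k` over all
decreasing binary trees on `{1,…,n}`. -/
def a (n k : ℕ) : ℕ := ((perms n).map fun l => countBal k (treeOf l)).sum

/-- `r n k`: the number of decreasing binary trees on `{1,…,n}` whose root is
balanced of rank `k`. -/
def r (n k : ℕ) : ℕ :=
  ((perms n).filter fun l => decide (balRank (treeOf l) = some k)).length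

/-- `p n k`: the probability that the root of a uniformly random decreasing
binary tree on `{1,…,n}` is balanced of rank `k`; by convention `p 0 k = 1`. -/
def p (n k : ℕ) : ℚ := if n = 0 then 1 else (r n k : ℚ) / (Nat.factorial n : ℚ)

/-- The number of decreasing binary trees on `{1,…,n}` whose root is balanced. -/
def rootBal (n : ℕ) : ℕ :=
  ((perms n).filter fun l => (balRank (treeOf l)).isSome).length

/-- `proot n`: the probability that the root of a uniformly random decreasing
binary tree on `{1,…,n}` is balanced. -/
def proot (n : ℕ) : ℚ := (rootBal n : ℚ) / (Nat.factorial n : ℚ)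

/-- The total number of balanced vertices over all decreasing binary trees
on `{1,…,n}`. -/
def totalBal (n : ℕ) : ℕ := ((perms n).map fun l => countBalAll (treeOf l)).sum

/-- `Pbal n`: the probability that a vertex chosen uniformly at random from
the `n * n!` vertices of all decreasing binary trees on `{1,…,n}` is balanced. -/
def Pbal (n : ℕ) : ℚ := (totalBal n : ℚ) / ((n : ℚ) * (Nat.factorial n : ℚ))

/-- Permutations whose decreasing binary tree is a canonical representative
of a non-plane 1-2 tree; these are in bijection with non-plane 1-2 trees
on `{1,…,n}`. -/
def npPerms (n : ℕ) : List (List ℕ) := (perms n).filter fun l => canonNP (treeOf l)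

/-- `E n`: the number of non-plane 1-2 trees on `{1,…,n}` (the Euler number). -/
def E (n : ℕ) : ℕ := (npPerms n).length

/-- `b n k`: the total number of balanced vertices of rank `k` over all
non-plane 1-2 trees on `{1,…,n}`. -/
def b (n k : ℕ) : ℕ := ((npPerms n).map fun l => countBal k (treeOf l)).sum

/-- `s n k`: the number of non-plane 1-2 trees on `{1,…,n}` whose root is
balanced of rank `k`. -/
def s (n k : ℕ) : ℕ :=
  ((npPerms n).filter fun l => decide (balRank (treeOf l) = some k)).length

/-- Permutations whose decreasing binary tree is a canonical representative
of a plane 1-2 tree; these are in bijection with plane 1-2 trees on `{1,…,n}`. -/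
def pPerms (n : ℕ) : List (List ℕ) := (perms n).filter fun l => canonP (treeOf l)

/-- `z n`: the number of plane 1-2 trees on `{1,…,n}`. -/
def z (n : ℕ) : ℕ := (pPerms n).length

/-- `d n k`: the total number of balanced vertices of rank `k` over all
plane 1-2 trees on `{1,…,n}`. -/
def d (n k : ℕ) : ℕ := ((pPerms n).map fun l => countBal k (treeOf l)).sum

/-- `t n k`: the number of plane 1-2 trees on `{1,…,n}` whose root is
balanced of rank `k`. -/
def t (n k : ℕ) : ℕ :=
  ((pPerms n).filter fun l => decide (balRank (treeOf l) = some k)).length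

end BalancedTrees

open BalancedTrees

namespace BalancedTrees

open BT

theorem foldr_max_mem {l : List ℕ} (hl : l ≠ []) : l.foldr max 0 ∈ l := by
  induction l with
  | nil => exact absurd rfl hl
  | cons x t ih =>
    rcases eq_or_ne t [] with rfl | ht
    · simp
    · rcases max_choice x (t.foldr max 0) with h | h
      · simp [h]
      · simp only [List.foldr_cons, h]
        exact List.mem_cons_of_mem _ (ih ht)

theorem length_takeWhile_ne_lt {m : ℕ} {l : List ℕ} (hm : m ∈ l) :
    (l.takeWhile (· != m)).length < l.length := by
  obtain ⟨l₁, l₂, rfl⟩ := List.append_of_mem hm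
  have : ((l₁ ++ m :: l₂).takeWhile (· != m)).length ≤ l₁.length := by
    induction l₁ with
    | nil => simp
    | cons x t ih =>
      by_cases hx : x = m
      · simp [hx]
      · simpa [hx] using ih (by simp)
  simp only [List.length_append, List.length_cons]
  omega

theorem length_tail_dropWhile_lt (q : ℕ → Bool) {l : List ℕ} (hl : l ≠ []) :
    (l.dropWhile q).tail.length < l.length := by
  have h₁ : (l.dropWhile q).length ≤ l.length := (List.dropWhile_sublist q).length_le
  have h₂ := List.length_pos_iff.2 hl
  rw [List.length_tail]
  omega

theorem treeOfAux_eq_of_length_le {k k' : ℕ} {l : List ℕ} (hk : l.length ≤ k)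
    (hk' : l.length ≤ k') : treeOfAux k l = treeOfAux k' l := by
  induction k generalizing k' l with
  | zero =>
    obtain rfl : l = [] := by simpa using hk
    cases k' <;> simp [treeOfAux]
  | succ k ih =>
    cases l with
    | nil => cases k' <;> simp [treeOfAux]
    | cons x t =>
      cases k' with
      | zero => simp at hk'
      | succ k' =>
        have hne : x :: t ≠ [] := by simp
        have h₁ := length_takeWhile_ne_lt (foldr_max_mem hne)
        have h₂ := length_tail_dropWhile_lt (· != (x :: t).foldr max 0) hne
        simp only [treeOfAux]
        rw [ih (k' := k') (by omega) (by omega), ih (k' := k') (by omega) (by omega)]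

theorem foldr_max_append_cons {m : ℕ} {l₁ l₂ : List ℕ} (h₁ : ∀ x ∈ l₁, x < m)
    (h₂ : ∀ x ∈ l₂, x < m) : (l₁ ++ m :: l₂).foldr max 0 = m := by
  have hmem := foldr_max_mem (l := l₁ ++ m :: l₂) (by simp)
  have hle : m ≤ (l₁ ++ m :: l₂).foldr max 0 := by
    rw [List.foldr_append]
    clear h₁ hmem
    induction l₁ with
    | nil => simp
    | cons x t ih => exact ih.trans (le_max_right _ _)
  rcases List.mem_append.1 hmem with h | h
  · exact absurd (h₁ _ h) (not_lt.2 hle)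
  · rcases List.mem_cons.1 h with h | h
    · exact h
    · exact absurd (h₂ _ h) (not_lt.2 hle)

theorem treeOf_append_cons {m : ℕ} {l₁ l₂ : List ℕ} (h₁ : ∀ x ∈ l₁, x < m)
    (h₂ : ∀ x ∈ l₂, x < m) :
    treeOf (l₁ ++ m :: l₂) = BT.node m (treeOf l₁) (treeOf l₂) := by
  have hp : ∀ x ∈ l₁, (x != m) = true := fun x hx => by simpa using (h₁ x hx).ne
  have ht : (l₁ ++ m :: l₂).takeWhile (· != m) = l₁ := by
    rw [List.takeWhile_append_of_pos hp]; simp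
  have hd : (l₁ ++ m :: l₂).dropWhile (· != m) = m :: l₂ := by
    rw [List.dropWhile_append_of_pos hp]; simp
  have hlen : (l₁ ++ m :: l₂).length = (l₁.length + l₂.length) + 1 := by simp; omega
  have key : ∀ (k : ℕ) (l : List ℕ), l ≠ [] → treeOfAux (k + 1) l =
      BT.node (l.foldr max 0) (treeOfAux k (l.takeWhile (· != l.foldr max 0)))
        (treeOfAux k ((l.dropWhile (· != l.foldr max 0)).tail)) := by
    intro k l hl
    cases l with
    | nil => exact absurd rfl hl
    | cons x t => rfl
  rw [treeOf, hlen, key _ _ (by simp), foldr_max_append_cons h₁ h₂, ht, hd, List.tail_cons,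
    treeOf, treeOf, treeOfAux_eq_of_length_le (k' := l₁.length) (by omega) le_rfl,
    treeOfAux_eq_of_length_le (l := l₂) (k' := l₂.length) (by omega) le_rfl]

theorem treeOf_eq_nil_iff {l : List ℕ} : treeOf l = BT.nil ↔ l = [] := by
  cases l <;> simp [treeOf, treeOfAux]

theorem canonP_node_iff (m : ℕ) (t₁ t₂ : BT) :
    canonP (BT.node m t₁ t₂) = true ↔
      canonP t₁ = true ∧ canonP t₂ = true ∧ (t₁ = BT.nil → t₂ = BT.nil) := by
  cases t₁ <;> cases t₂ <;> simp [canonP]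

theorem canonP_treeOf_append_cons {m : ℕ} {l₁ l₂ : List ℕ} (h₁ : ∀ x ∈ l₁, x < m)
    (h₂ : ∀ x ∈ l₂, x < m) :
    canonP (treeOf (l₁ ++ m :: l₂)) = true ↔
      canonP (treeOf l₁) = true ∧ canonP (treeOf l₂) = true ∧ (l₁ = [] → l₂ = []) := by
  rw [treeOf_append_cons h₁ h₂, canonP_node_iff, treeOf_eq_nil_iff, treeOf_eq_nil_iff]

/-- The orderings of a finite label set `S` whose decreasing binary tree is a canonical
representative of a plane 1-2 tree on `S`. -/
noncomputable def canonLists (S : Finset ℕ) : Finset (List ℕ) :=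
  {l ∈ S.toList.permutations.toFinset | canonP (treeOf l) = true}

theorem mem_canonLists {S : Finset ℕ} {l : List ℕ} :
    l ∈ canonLists S ↔ l.Nodup ∧ l.toFinset = S ∧ canonP (treeOf l) = true := by
  have : l.Perm S.toList ↔ l.Nodup ∧ l.toFinset = S := by
    constructor
    · intro h
      exact ⟨h.nodup_iff.2 S.nodup_toList, by rw [List.toFinset_eq_of_perm _ _ h]; simp⟩
    · rintro ⟨h, rfl⟩
      exact (List.toFinset_toList h).symm
  simp [canonLists, this, and_assoc]

theorem z_eq_card_canonLists (n : ℕ) : z n = (canonLists (Finset.Icc 1 n)).card := by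
  have hnd : (pPerms n).Nodup := (List.nodup_permutations _ List.nodup_range').filter _
  rw [z, ← List.toFinset_card_of_nodup hnd]
  congr 1
  ext l
  have hS : (List.range' 1 n).toFinset = Finset.Icc 1 n := by
    ext x; simp [List.mem_range'_1]; omega
  have hp : l.Perm (List.range' 1 n) ↔ l.Nodup ∧ l.toFinset = Finset.Icc 1 n := by
    rw [← hS]
    constructor
    · exact fun h => ⟨h.nodup_iff.2 List.nodup_range', List.toFinset_eq_of_perm _ _ h⟩
    · exact fun h => List.perm_of_nodup_nodup_toFinset_eq h.1 List.nodup_range' h.2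
  simp [pPerms, perms, mem_canonLists, hp, and_assoc]

theorem canonLists_empty : canonLists ∅ = {[]} := by
  ext l
  simp only [mem_canonLists, List.toFinset_eq_empty_iff, Finset.mem_singleton]
  constructor
  · exact fun h => h.2.1
  · rintro rfl
    simp [treeOf, treeOfAux, canonP]

theorem card_canonLists_insert {S : Finset ℕ} {m : ℕ} (hm : ∀ x ∈ S, x < m) :
    (canonLists (insert m S)).card =
      ∑ T ∈ S.powerset, if T = ∅ ∧ S ≠ ∅ then 0 else
        (canonLists T).card * (canonLists (S \ T)).card := by
  have hmS : m ∉ S := fun h => lt_irrefl _ (hm m h)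
  have hsum : (∑ T ∈ S.powerset, if T = ∅ ∧ S ≠ ∅ then 0 else
        (canonLists T).card * (canonLists (S \ T)).card) =
      ((S.powerset.filter fun T => ¬(T = ∅ ∧ S ≠ ∅)).sigma fun T =>
        canonLists T ×ˢ canonLists (S \ T)).card := by
    rw [Finset.card_sigma, Finset.sum_filter]
    refine Finset.sum_congr rfl fun T _ => ?_
    by_cases h : T = ∅ ∧ S ≠ ∅ <;> simp [h, Finset.card_product]
  rw [hsum]
  symm
  refine Finset.card_bij (fun q _ => q.2.1 ++ m :: q.2.2) ?_ ?_ ?_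
  · rintro ⟨T, l₁, l₂⟩ h
    simp only [Finset.mem_sigma, Finset.mem_filter, Finset.mem_powerset, Finset.mem_product,
      mem_canonLists] at h
    obtain ⟨⟨hT, hne⟩, ⟨hn₁, rfl, hc₁⟩, hn₂, ht₂, hc₂⟩ := h
    have hs₁ : ∀ x ∈ l₁, x ∈ S := fun x hx => hT (List.mem_toFinset.2 hx)
    have hs₂ : ∀ x ∈ l₂, x ∈ S ∧ x ∉ l₁ := fun x hx => by
      have := List.mem_toFinset.2 hx
      rw [ht₂] at this
      simpa using this
    rw [mem_canonLists, canonP_treeOf_append_cons (fun x hx => hm x (hs₁ x hx))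
      (fun x hx => hm x (hs₂ x hx).1)]
    refine ⟨?_, ?_, hc₁, hc₂, ?_⟩
    · rw [List.nodup_append]
      refine ⟨hn₁, List.nodup_cons.2 ⟨fun h => hmS (hs₂ m h).1, hn₂⟩, ?_⟩
      rintro x hx y hy rfl
      rcases List.mem_cons.1 hy with rfl | hy
      · exact hmS (hs₁ _ hx)
      · exact (hs₂ _ hy).2 hx
    · rw [List.toFinset_append, List.toFinset_cons, ht₂, Finset.union_insert,
        Finset.union_sdiff_of_subset hT]
    · rintro rfl
      have : S = ∅ := by simpa using hne
      simpa [this] using ht₂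
  · rintro ⟨T, l₁, l₂⟩ h ⟨T', l₁', l₂'⟩ h' heq
    simp only [Finset.mem_sigma, Finset.mem_filter, Finset.mem_powerset, Finset.mem_product,
      mem_canonLists] at h h'
    obtain ⟨⟨hT, -⟩, ⟨-, rfl, -⟩, -, ht₂, -⟩ := h
    obtain ⟨-, ⟨-, rfl, -⟩, -⟩ := h'
    have hn₁ : m ∉ l₁ := fun h => hmS (hT (List.mem_toFinset.2 h))
    have hn₂ : m ∉ l₂ := fun h => by
      have := List.mem_toFinset.2 h
      rw [ht₂] at this
      exact hmS (Finset.mem_sdiff.1 this).1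
    obtain ⟨rfl, -, rfl⟩ := (List.append_cons_inj_of_notMem hn₁ hn₂).1 heq
    rfl
  · intro l hl
    obtain ⟨hn, ht, hc⟩ := mem_canonLists.1 hl
    have hml : m ∈ l := by rw [← List.mem_toFinset, ht]; simp
    obtain ⟨l₁, l₂, rfl⟩ := List.append_of_mem hml
    have hmem : ∀ x, (x ∈ l₁ ∨ x = m ∨ x ∈ l₂) ↔ (x = m ∨ x ∈ S) := fun x => by
      simpa [or_left_comm] using Finset.ext_iff.1 ht x
    rw [List.nodup_append, List.nodup_cons] at hn
    obtain ⟨hn₁, ⟨hm₂, hn₂⟩, hdisj⟩ := hn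
    have hs₁ : ∀ x ∈ l₁, x ∈ S := fun x hx =>
      ((hmem x).1 (Or.inl hx)).resolve_left (hdisj x hx m (by simp))
    have hs₂ : ∀ x ∈ l₂, x ∈ S := fun x hx =>
      ((hmem x).1 (Or.inr (Or.inr hx))).resolve_left (by rintro rfl; exact hm₂ hx)
    rw [canonP_treeOf_append_cons (fun x hx => hm x (hs₁ x hx)) (fun x hx => hm x (hs₂ x hx))] at hc
    have ht₂ : l₂.toFinset = S \ l₁.toFinset := by
      ext x
      simp only [List.mem_toFinset, Finset.mem_sdiff]
      constructor
      · exact fun hx => ⟨hs₂ x hx, fun hx₁ => hdisj x hx₁ x (by simp [hx]) rfl⟩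
      · rintro ⟨hxS, hx₁⟩
        rcases (hmem x).2 (Or.inr hxS) with h | rfl | h
        · exact absurd h hx₁
        · exact absurd hxS hmS
        · exact h
    refine ⟨⟨l₁.toFinset, l₁, l₂⟩, ?_, rfl⟩
    simp only [Finset.mem_sigma, Finset.mem_filter, Finset.mem_powerset, Finset.mem_product,
      mem_canonLists]
    refine ⟨⟨fun x hx => hs₁ x (List.mem_toFinset.1 hx), ?_⟩, ⟨hn₁, trivial, hc.1⟩, hn₂, ht₂, hc.2.1⟩
    rintro ⟨h₁, hS⟩
    have h₁' := List.toFinset_eq_empty_iff _ |>.1 h₁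
    rw [hc.2.2 h₁', h₁'] at ht₂
    exact hS (by simpa using ht₂.symm)

theorem exists_insert_max {S : Finset ℕ} {n : ℕ} (hS : S.card = n + 1) :
    ∃ m S', (∀ x ∈ S', x < m) ∧ S'.card = n ∧ S = insert m S' := by
  have hne : S.Nonempty := Finset.card_pos.1 (by omega)
  have hmem := S.max'_mem hne
  refine ⟨S.max' hne, S.erase (S.max' hne), fun x hx => S.lt_max'_of_mem_erase_max' hne hx, ?_,
    (Finset.insert_erase hmem).symm⟩
  rw [Finset.card_erase_of_mem hmem, hS, Nat.add_sub_cancel]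

theorem card_canonLists_eq_of_card_eq {S S' : Finset ℕ} (h : S.card = S'.card) :
    (canonLists S).card = (canonLists S').card := by
  induction hn : S.card using Nat.strong_induction_on generalizing S S' with
  | _ n ih =>
    cases n with
    | zero =>
      rw [Finset.card_eq_zero.1 hn, Finset.card_eq_zero.1 (h.symm.trans hn)]
    | succ n =>
      obtain ⟨F, key⟩ : ∃ F : ℕ → ℕ, ∀ U : Finset ℕ, U.card = n → ∀ T ∈ U.powerset,
          (if T = ∅ ∧ U ≠ ∅ then 0 else (canonLists T).card * (canonLists (U \ T)).card) =
            F T.card := by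
        refine ⟨fun i => if i = 0 ∧ n ≠ 0 then 0 else (canonLists (Finset.range i)).card *
          (canonLists (Finset.range (n - i))).card, ?_⟩
        rintro U rfl T hT
        have hTU := Finset.mem_powerset.1 hT
        have hle := Finset.card_le_card hTU
        have hsd := Finset.card_sdiff_of_subset hTU
        simp only [Finset.card_eq_zero, ne_eq]
        rw [ih T.card (by omega) (S' := Finset.range T.card) (by simp) rfl,
          ih (U \ T).card (by omega) (S' := Finset.range (U.card - T.card)) (by simp [hsd]) rfl]
      obtain ⟨m, U, hm, hU, rfl⟩ := exists_insert_max hn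
      obtain ⟨m', U', hm', hU', rfl⟩ := exists_insert_max (h.symm.trans hn)
      rw [card_canonLists_insert hm, card_canonLists_insert hm', Finset.sum_congr rfl (key U hU),
        Finset.sum_congr rfl (key U' hU'), Finset.sum_powerset_apply_card F,
        Finset.sum_powerset_apply_card F, hU, hU']

theorem card_canonLists (S : Finset ℕ) : (canonLists S).card = z S.card := by
  rw [z_eq_card_canonLists]
  exact card_canonLists_eq_of_card_eq (by simp)

theorem z_zero : z 0 = 1 := by
  rw [z_eq_card_canonLists]
  simp [canonLists_empty]

theorem z_succ_eq_sum (n : ℕ) :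
    z (n + 1) = ∑ i ∈ Finset.range (n + 1),
      n.choose i * if i = 0 ∧ n ≠ 0 then 0 else z i * z (n - i) := by
  have hm : ∀ x ∈ Finset.range n, x < n := fun x hx => Finset.mem_range.1 hx
  have h := card_canonLists_insert hm
  rw [card_canonLists, Finset.card_insert_of_notMem (by simp), Finset.card_range] at h
  have hF := Finset.sum_powerset_apply_card (x := Finset.range n)
    fun i => if i = 0 ∧ n ≠ 0 then 0 else z i * z (n - i)
  simp only [Finset.card_range, smul_eq_mul] at hF
  rw [h, ← hF]
  refine Finset.sum_congr rfl fun T hT => ?_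
  simp [card_canonLists, Finset.card_sdiff_of_subset (Finset.mem_powerset.1 hT)]

theorem z_succ (n : ℕ) :
    (z (n + 1) : ℤ) =
      (∑ i ∈ Finset.range (n + 1), (n.choose i : ℤ) * z i * z (n - i)) -
        z n + (if n = 0 then 1 else 0) := by
  rw [z_succ_eq_sum]
  rcases eq_or_ne n 0 with rfl | hn
  · simp [z_zero]
  · rw [Finset.sum_range_succ', Finset.sum_range_succ']
    simp [hn, z_zero, mul_assoc]

/-- The closed form of the exponential generating function of `z`, on the complex plane. -/
noncomputable def egf (w : ℂ) : ℂ :=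
  (Real.sqrt 3 / 2 : ℝ) * Complex.tan ((Real.sqrt 3 / 2 : ℝ) * w + (Real.pi / 6 : ℝ)) + 1 / 2

theorem cos_ne_zero_of_norm_lt {w : ℂ} (hw : ‖w‖ < 2 * Real.pi / (3 * Real.sqrt 3)) :
    Complex.cos ((Real.sqrt 3 / 2 : ℝ) * w + (Real.pi / 6 : ℝ)) ≠ 0 := by
  intro h
  obtain ⟨k, hk⟩ := Complex.cos_eq_zero_iff.1 h
  have hre := congrArg Complex.re hk
  have hrhs : ((2 * (k : ℂ) + 1) * Real.pi / 2).re = (2 * (k : ℝ) + 1) * Real.pi / 2 := by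
    rw [← Complex.ofReal_re ((2 * (k : ℝ) + 1) * Real.pi / 2)]
    push_cast
    rfl
  rw [hrhs, Complex.add_re, Complex.re_ofReal_mul, Complex.ofReal_re] at hre
  have hs : 0 < Real.sqrt 3 := by positivity
  have hb : Real.sqrt 3 / 2 * |w.re| < Real.pi / 3 := by
    have h₁ := (Complex.abs_re_le_norm w).trans_lt hw
    rw [lt_div_iff₀ (by positivity)] at h₁
    linarith
  have hb' : |Real.sqrt 3 / 2 * w.re| < Real.pi / 3 := by
    rwa [abs_mul, abs_of_pos (by positivity : 0 < Real.sqrt 3 / 2)]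
  obtain ⟨hl, hu⟩ := abs_lt.1 hb'
  have hpi := Real.pi_pos
  have hk₁ : (k : ℝ) < 0 := by
    by_contra! hk₀
    nlinarith
  have hk₂ : (-1 : ℝ) < k := by
    by_contra! hk₀
    nlinarith
  have hk₁' : k < 0 := by exact_mod_cast hk₁
  have hk₂' : -1 < k := by exact_mod_cast hk₂
  omega

theorem hasDerivAt_egf {w : ℂ} (hw : ‖w‖ < 2 * Real.pi / (3 * Real.sqrt 3)) :
    HasDerivAt egf (egf w * egf w - egf w + 1) w := by
  have hc := cos_ne_zero_of_norm_lt hw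
  have hlin : HasDerivAt (fun w : ℂ => (Real.sqrt 3 / 2 : ℝ) * w + (Real.pi / 6 : ℝ))
      (Real.sqrt 3 / 2 : ℝ) w := by
    simpa using ((hasDerivAt_id w).const_mul ((Real.sqrt 3 / 2 : ℝ) : ℂ)).add_const
      ((Real.pi / 6 : ℝ) : ℂ)
  have h := (((Complex.hasDerivAt_tan hc).comp w hlin).const_mul
    ((Real.sqrt 3 / 2 : ℝ) : ℂ)).add_const (1 / 2 : ℂ)
  refine HasDerivAt.congr_deriv h ?_
  have h3 : ((Real.sqrt 3 / 2 : ℝ) : ℂ) ^ 2 = 3 / 4 := by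
    rw [← Complex.ofReal_pow, div_pow, Real.sq_sqrt (by norm_num)]
    norm_num
  rw [egf, Complex.tan]
  set u := ((Real.sqrt 3 / 2 : ℝ) : ℂ) * w + (Real.pi / 6 : ℝ)
  set c := ((Real.sqrt 3 / 2 : ℝ) : ℂ)
  have hsc := Complex.sin_sq_add_cos_sq u
  have hone : 1 / Complex.cos u ^ 2 = (Complex.sin u / Complex.cos u) ^ 2 + 1 := by
    field_simp
    exact hsc.symm
  rw [hone]
  linear_combination h3

theorem differentiableOn_egf :
    DifferentiableOn ℂ egf (Metric.ball 0 (2 * Real.pi / (3 * Real.sqrt 3))) :=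
  fun w hw => (hasDerivAt_egf (by simpa using hw)).differentiableAt.differentiableWithinAt

theorem egf_zero : egf 0 = 1 := by
  have h : Real.sqrt 3 / 2 * Real.tan (Real.pi / 6) + 1 / 2 = 1 := by
    rw [Real.tan_pi_div_six]
    field_simp
    norm_num
  rw [egf, mul_zero, zero_add, ← Complex.ofReal_tan]
  simpa using congrArg ((↑) : ℝ → ℂ) h

theorem iteratedDeriv_egf_zero (n : ℕ) : iteratedDeriv n egf 0 = z n := by
  have hR : 0 < 2 * Real.pi / (3 * Real.sqrt 3) := by positivity
  have hball : Metric.ball (0 : ℂ) (2 * Real.pi / (3 * Real.sqrt 3)) ∈ nhds 0 :=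
    Metric.ball_mem_nhds 0 hR
  have hcd : ∀ k : ℕ, ContDiffAt ℂ k egf 0 := fun k => (differentiableOn_egf.analyticAt hball).contDiffAt
  induction n using Nat.strong_induction_on with
  | _ n ih =>
    cases n with
    | zero => simp [egf_zero, z_zero]
    | succ n =>
      have hev : deriv egf =ᶠ[nhds 0] fun w => egf w * egf w - egf w + 1 := by
        filter_upwards [hball] with w hw
        exact (hasDerivAt_egf (by simpa using hw)).deriv
      have hz := congrArg (Int.cast : ℤ → ℂ) (z_succ n)
      push_cast at hz
      rw [iteratedDeriv_succ', (hev.iteratedDeriv n).eq_of_nhds,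
        iteratedDeriv_fun_add (((hcd n).mul (hcd n)).sub (hcd n)) contDiffAt_const,
        iteratedDeriv_fun_sub ((hcd n).mul (hcd n)) (hcd n),
        iteratedDeriv_fun_mul (hcd n) (hcd n), iteratedDeriv_const, hz, ih n (by omega)]
      congr 2
      refine Finset.sum_congr rfl fun i hi => ?_
      rw [ih i (by simpa using hi), ih (n - i) (by omega)]

theorem hasSum_egf {x : ℝ} (hx : |x| < 2 * Real.pi / (3 * Real.sqrt 3)) :
    HasSum (fun n : ℕ => (z n : ℝ) * x ^ n / (Nat.factorial n : ℝ))
      (Real.sqrt 3 / 2 * Real.tan (Real.sqrt 3 / 2 * x + Real.pi / 6) + 1 / 2) := by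
  have h := Complex.hasSum_taylorSeries_on_ball differentiableOn_egf (z := (x : ℂ)) (by simpa using hx)
  rw [← Complex.hasSum_ofReal]
  have hval : egf x = ((Real.sqrt 3 / 2 * Real.tan (Real.sqrt 3 / 2 * x + Real.pi / 6) +
      1 / 2 : ℝ) : ℂ) := by
    rw [egf]
    push_cast
    rfl
  rw [← hval]
  refine h.congr_fun fun n => ?_
  rw [iteratedDeriv_egf_zero]
  push_cast
  simp only [smul_eq_mul, sub_zero]
  ring

end BalancedTrees

/-- The numbers `z(n)` of plane 1-2 trees satisfy `z(0) = 1` and the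
recurrence `z(n+1) = (∑_{i=0}^{n} C(n,i) z(i) z(n-i)) - z(n) + δ_{n,0}`,
which is the coefficientwise form of `Z'(x) = Z(x)² - Z(x) + 1`, `Z(0) = 1`;
hence their exponential generating function equals
`(√3/2)·tan((√3/2)x + π/6) + 1/2` (within the radius of convergence). -/
theorem statement15 :
    z 0 = 1 ∧
    (∀ n : ℕ,
      (z (n + 1) : ℤ) =
        (∑ i ∈ Finset.range (n + 1), (n.choose i : ℤ) * z i * z (n - i)) -
          z n + (if n = 0 then 1 else 0)) ∧
    (∀ x : ℝ, |x| < 2 * Real.pi / (3 * Real.sqrt 3) →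
      HasSum (fun n : ℕ => (z n : ℝ) * x ^ n / (Nat.factorial n : ℝ))
        (Real.sqrt 3 / 2 * Real.tan (Real.sqrt 3 / 2 * x + Real.pi / 6) +
          1 / 2)) := by
  exact ⟨z_zero, z_succ, fun x hx => hasSum_egf hx⟩
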